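/- arXiv:2003.11749 — 2 statements merged into one kernel-verified Lean document; each statement's English description precedes it below -/
import Mathlib

section
/- For all integers k ≥ 0 and n ≥ 2k, the variance of the number of k-dimensional subcubes contained in a uniformly random Boolean function of length n is E[(X_k − μ)²] = Σ_{i=0}^{k} [ n! / (i! · (k−i)! · (k−i)! · (n−2k+i)!) ] · 2^{n−i} · (2^{2^i} − 1) / 2^{2^{k+1}}, where μ = E[X_k] = C(n,k)·2^{n−k}/2^{2^k}. -/
open Finset

/-- The number of `k`-dimensional subcubes of `{0,1}^n` contained in a Boolean function
`f ⊆ {0,1}^n`. A `k`-dimensional subcube is encoded by a set `T` of `k` free coordinates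
together with a function `a : Fin n → Bool` vanishing on `T` (its values outside `T` are the
fixed coordinates); the subcube consists of all points agreeing with `a` outside `T`. -/
def subcubeCount (n k : ℕ) (f : Finset (Fin n → Bool)) : ℕ :=
  ((univ : Finset (Finset (Fin n) × (Fin n → Bool))).filter
    (fun p => p.1.card = k ∧ (∀ i ∈ p.1, p.2 i = false) ∧
      ∀ x : Fin n → Bool, (∀ i, i ∉ p.1 → x i = p.2 i) → x ∈ f)).card

/-- The subcube through `a` with set of free coordinates `T`. -/
def subcube {n : ℕ} (T : Finset (Fin n)) (a : Fin n → Bool) : Finset (Fin n → Bool) :=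
  univ.filter fun x => ∀ i, i ∉ T → x i = a i

/-- The normalised assignments for the free coordinates `T`: those vanishing on `T`. -/
def assignments {n : ℕ} (T : Finset (Fin n)) : Finset (Fin n → Bool) :=
  univ.filter fun a => ∀ i ∈ T, a i = false

/-- The codes of all `k`-dimensional subcubes of `{0,1}^n`. -/
def subcubeCodes (n k : ℕ) : Finset (Σ _ : Finset (Fin n), Fin n → Bool) :=
  (powersetCard k univ).sigma assignments

theorem mem_subcube {n : ℕ} {T : Finset (Fin n)} {a x : Fin n → Bool} :
    x ∈ subcube T a ↔ ∀ i, i ∉ T → x i = a i := by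
  simp [subcube]

theorem mem_assignments {n : ℕ} {T : Finset (Fin n)} {a : Fin n → Bool} :
    a ∈ assignments T ↔ ∀ i ∈ T, a i = false := by
  simp [assignments]

theorem card_subcube {n : ℕ} (T : Finset (Fin n)) (a : Fin n → Bool) :
    (subcube T a).card = 2 ^ T.card := by
  have h : subcube T a = Fintype.piFinset fun i => if i ∈ T then univ else {a i} := by
    ext x
    simp only [mem_subcube, Fintype.mem_piFinset]
    refine forall_congr' fun i => ?_
    by_cases hi : i ∈ T <;> simp [hi]
  rw [h, Fintype.card_piFinset]
  simp [apply_ite Finset.card]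

theorem card_assignments {n : ℕ} (T : Finset (Fin n)) :
    (assignments T).card = 2 ^ (n - T.card) := by
  have h : assignments T = subcube Tᶜ fun _ => false := by
    ext x
    simp [mem_assignments, mem_subcube]
  rw [h, card_subcube, card_compl, Fintype.card_fin]

theorem card_subcubeCodes (n k : ℕ) :
    (subcubeCodes n k).card = n.choose k * 2 ^ (n - k) := by
  rw [subcubeCodes, card_sigma, sum_congr rfl (g := fun _ => 2 ^ (n - k))]
  · simp
  · intro T hT
    rw [card_assignments, (mem_powersetCard.1 hT).2]

theorem subcubeCount_eq_sum (n k : ℕ) (f : Finset (Fin n → Bool)) :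
    (subcubeCount n k f : ℝ) =
      ∑ p ∈ subcubeCodes n k, if subcube p.1 p.2 ⊆ f then 1 else 0 := by
  rw [← Finset.sum_filter, Finset.sum_const, nsmul_one, subcubeCount]
  congr 1
  refine card_nbij' (fun p => ⟨p.1, p.2⟩) (fun p => (p.1, p.2)) ?_ ?_ ?_ ?_
  · intro p hp
    simpa [subcubeCodes, mem_assignments, subset_iff, mem_subcube, and_assoc] using hp
  · intro p hp
    simpa [subcubeCodes, mem_assignments, subset_iff, mem_subcube, and_assoc] using hp
  · intro p _; rfl
  · intro p _; rfl

/-- Every point lies in exactly one subcube with free coordinates `T`. -/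
theorem sum_assignments_mem_subcube {n : ℕ} (T : Finset (Fin n)) (x : Fin n → Bool) :
    ∑ a ∈ assignments T, (if x ∈ subcube T a then (1 : ℝ) else 0) = 1 := by
  rw [Finset.sum_eq_single (fun i => if i ∈ T then false else x i)]
  · rw [if_pos]
    rw [mem_subcube]
    intro i hi
    simp [hi]
  · intro a ha hne
    rw [if_neg]
    intro hx
    apply hne
    funext i
    by_cases hi : i ∈ T
    · simp [hi, mem_assignments.1 ha i hi]
    · simp [hi, mem_subcube.1 hx i hi]
  · intro h
    exact absurd (mem_assignments.2 fun i hi => by simp [hi]) h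

theorem sum_card_subcube_inter {n : ℕ} (T U : Finset (Fin n)) :
    ∑ a ∈ assignments T, ∑ b ∈ assignments U, ((subcube T a ∩ subcube U b).card : ℝ) = 2 ^ n := by
  have h : ∀ a b : Fin n → Bool, ((subcube T a ∩ subcube U b).card : ℝ) =
      ∑ x : Fin n → Bool, (if x ∈ subcube T a then (1 : ℝ) else 0) *
        (if x ∈ subcube U b then (1 : ℝ) else 0) := by
    intro a b
    simp only [ite_zero_mul_ite_zero, mul_one, ← mem_inter, sum_boole, filter_univ_mem]
  calc _ = ∑ x : Fin n → Bool, (∑ a ∈ assignments T, if x ∈ subcube T a then (1 : ℝ) else 0) *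
        (∑ b ∈ assignments U, if x ∈ subcube U b then (1 : ℝ) else 0) := by
        simp only [h, sum_mul_sum]
        rw [sum_congr rfl fun a _ => sum_comm, sum_comm]
    _ = 2 ^ n := by simp only [sum_assignments_mem_subcube]; simp

theorem card_subcube_inter {n : ℕ} (T U : Finset (Fin n)) (a b : Fin n → Bool) :
    (subcube T a ∩ subcube U b).card = 0 ∨
      (subcube T a ∩ subcube U b).card = 2 ^ (T ∩ U).card := by
  rcases (subcube T a ∩ subcube U b).eq_empty_or_nonempty with h | ⟨x, hx⟩
  · simp [h]
  · right
    rw [← card_subcube (T ∩ U) x]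
    congr 1
    rw [mem_inter, mem_subcube, mem_subcube] at hx
    ext y
    simp only [mem_inter, mem_subcube]
    refine ⟨fun h i hi => ?_, fun h => ⟨fun i hi => ?_, fun i hi => ?_⟩⟩
    · by_cases hT : i ∈ T
      · have hU : i ∉ U := fun hU => hi ⟨hT, hU⟩
        rw [h.2 i hU, hx.2 i hU]
      · rw [h.1 i hT, hx.1 i hT]
    · rw [h i fun h' => hi h'.1, hx.1 i hi]
    · rw [h i fun h' => hi h'.2, hx.2 i hi]

theorem sum_two_pow_card_subcube_inter_sub_one {n : ℕ} (T U : Finset (Fin n)) :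
    ∑ a ∈ assignments T, ∑ b ∈ assignments U,
        ((2 : ℝ) ^ (subcube T a ∩ subcube U b).card - 1) =
      2 ^ (n - (T ∩ U).card) * (2 ^ 2 ^ (T ∩ U).card - 1) := by
  have h : ∀ a b : Fin n → Bool, (2 : ℝ) ^ (subcube T a ∩ subcube U b).card - 1 =
      ((2 : ℝ) ^ 2 ^ (T ∩ U).card - 1) / 2 ^ (T ∩ U).card *
        ((subcube T a ∩ subcube U b).card : ℝ) := by
    intro a b
    rcases card_subcube_inter T U a b with h | h <;> rw [h] <;> simp
  simp only [h, ← mul_sum, sum_card_subcube_inter]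
  have hle : (T ∩ U).card ≤ n := by simpa using card_le_univ (T ∩ U)
  rw [pow_sub₀ _ two_ne_zero hle]
  ring

theorem card_filter_card_inter_eq {n k i : ℕ} (T : Finset (Fin n)) (hi : i ≤ k) :
    ((powersetCard k univ).filter fun U => (T ∩ U).card = i).card =
      T.card.choose i * (n - T.card).choose (k - i) := by
  have h : (powersetCard i T ×ˢ powersetCard (k - i) Tᶜ).card =
      T.card.choose i * (n - T.card).choose (k - i) := by
    simp [card_compl]
  rw [← h]
  refine card_nbij' (fun U => (T ∩ U, Tᶜ ∩ U)) (fun p => p.1 ∪ p.2) ?_ ?_ ?_ ?_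
  · intro U hU
    simp only [mem_coe, mem_filter, mem_powersetCard, mem_product] at hU ⊢
    refine ⟨⟨inter_subset_left, hU.2⟩, inter_subset_left, ?_⟩
    have := card_inter_add_card_sdiff U T
    rw [sdiff_eq_inter_compl, inter_comm U T, inter_comm U] at this
    omega
  · rintro ⟨A, B⟩ h
    simp only [mem_coe, mem_filter, mem_powersetCard, mem_product] at h ⊢
    obtain ⟨⟨hA, hAi⟩, hB, hBi⟩ := h
    have hd : Disjoint T B := disjoint_left.2 fun x hx hxB => (mem_compl.1 (hB hxB)) hx
    refine ⟨⟨subset_univ _, ?_⟩, ?_⟩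
    · rw [card_union_of_disjoint (hd.mono_left hA)]
      omega
    · rw [inter_union_distrib_left, inter_eq_right.2 hA, disjoint_iff_inter_eq_empty.1 hd,
        union_empty, hAi]
  · intro U _
    ext x
    by_cases hx : x ∈ T <;> simp [hx]
  · rintro ⟨A, B⟩ h
    simp only [mem_coe, mem_powersetCard, mem_product] at h
    obtain ⟨⟨hA, -⟩, hB, -⟩ := h
    ext x
    · have := @hA x
      have := @hB x
      simp only [mem_compl, mem_inter, mem_union] at *
      tauto
    · have := @hA x
      have := @hB x
      simp only [mem_compl, mem_inter, mem_union] at *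
      tauto

theorem sum_powersetCard_card_inter (n k : ℕ) (g : ℕ → ℝ) :
    ∑ T ∈ powersetCard k (univ : Finset (Fin n)), ∑ U ∈ powersetCard k (univ : Finset (Fin n)),
        g (T ∩ U).card =
      ∑ i ∈ range (k + 1),
        (n.choose k : ℝ) * (k.choose i : ℝ) * ((n - k).choose (k - i) : ℝ) * g i := by
  have h : ∀ T ∈ powersetCard k (univ : Finset (Fin n)),
      ∑ U ∈ powersetCard k (univ : Finset (Fin n)), g (T ∩ U).card =
        ∑ i ∈ range (k + 1), (k.choose i : ℝ) * ((n - k).choose (k - i) : ℝ) * g i := by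
    intro T hT
    have hTk := (mem_powersetCard.1 hT).2
    rw [← sum_fiberwise_of_maps_to (t := range (k + 1)) (g := fun U => (T ∩ U).card)]
    · refine sum_congr rfl fun i hi => ?_
      rw [sum_congr rfl (g := fun _ => g i) fun U hU => by rw [(mem_filter.1 hU).2],
        sum_const, card_filter_card_inter_eq T (Nat.lt_succ_iff.1 (mem_range.1 hi)), hTk,
        nsmul_eq_mul]
      push_cast
      ring
    · intro U _
      have := card_le_card (inter_subset_left : T ∩ U ⊆ T)
      exact mem_range.2 (by omega)
  rw [sum_congr rfl h, sum_const, card_powersetCard, card_univ, Fintype.card_fin, nsmul_eq_mul,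
    mul_sum]
  exact sum_congr rfl fun i _ => by ring

theorem choose_mul_choose_mul_choose_eq {n k i : ℕ} (hk : 2 * k ≤ n) (hi : i ≤ k) :
    (n.choose k : ℝ) * (k.choose i : ℝ) * ((n - k).choose (k - i) : ℝ) =
      (n.factorial : ℝ) / ((i.factorial : ℝ) * ((k - i).factorial : ℝ) *
        ((k - i).factorial : ℝ) * ((n - 2 * k + i).factorial : ℝ)) := by
  rw [Nat.cast_choose ℝ (by omega : k ≤ n), Nat.cast_choose ℝ hi,
    Nat.cast_choose ℝ (by omega : k - i ≤ n - k),
    show n - k - (k - i) = n - 2 * k + i by omega]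
  field_simp

theorem sum_ite_subset {α : Type*} [Fintype α] [DecidableEq α] (s : Finset α) :
    ∑ f : Finset α, (if s ⊆ f then (1 : ℝ) else 0) = 2 ^ Fintype.card α / 2 ^ s.card := by
  have h : (univ.filter fun f : Finset α => s ⊆ f) = Icc s univ := by
    ext f
    simp
  rw [← sum_filter, sum_const, nsmul_one, h, card_Icc_finset (subset_univ s), card_univ]
  push_cast
  rw [pow_sub₀ _ two_ne_zero (card_le_univ s), div_eq_mul_inv]

/-- The variance of a sum of indicators of the events `s j ⊆ f`, for sets `s j` of the same
cardinality. -/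
theorem variance_sum_ite_subset {α ι : Type*} [Fintype α] [DecidableEq α] (P : Finset ι)
    (s : ι → Finset α) (m : ℕ) (hs : ∀ p ∈ P, (s p).card = m) :
    (1 / (2 : ℝ) ^ Fintype.card α) * ∑ f : Finset α,
        ((∑ p ∈ P, if s p ⊆ f then (1 : ℝ) else 0) - P.card / 2 ^ m) ^ 2 =
      (∑ p ∈ P, ∑ q ∈ P, ((2 : ℝ) ^ (s p ∩ s q).card - 1)) / 2 ^ (2 * m) := by
  have hcov : ∀ p ∈ P, ∀ q ∈ P,
      ∑ f : Finset α, ((if s p ⊆ f then (1 : ℝ) else 0) - 1 / 2 ^ m) *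
          ((if s q ⊆ f then (1 : ℝ) else 0) - 1 / 2 ^ m) =
        2 ^ Fintype.card α * (((2 : ℝ) ^ (s p ∩ s q).card - 1) / 2 ^ (2 * m)) := by
    intro p hp q hq
    have hexp : ∀ f : Finset α, ((if s p ⊆ f then (1 : ℝ) else 0) - 1 / 2 ^ m) *
          ((if s q ⊆ f then (1 : ℝ) else 0) - 1 / 2 ^ m) =
        (if s p ∪ s q ⊆ f then (1 : ℝ) else 0) -
          1 / 2 ^ m * (if s p ⊆ f then (1 : ℝ) else 0) -
          1 / 2 ^ m * (if s q ⊆ f then (1 : ℝ) else 0) + 1 / 2 ^ m * (1 / 2 ^ m) := by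
      intro f
      by_cases h1 : s p ⊆ f <;> by_cases h2 : s q ⊆ f <;> simp [h1, h2, union_subset_iff] <;> ring
    simp only [hexp, sum_add_distrib, sum_sub_distrib, ← mul_sum, sum_ite_subset, hs p hp,
      hs q hq]
    have hcard : (2 : ℝ) ^ (s p ∪ s q).card * 2 ^ (s p ∩ s q).card = 2 ^ (2 * m) := by
      rw [← pow_add, card_union_add_card_inter, hs p hp, hs q hq, two_mul]
    rw [sub_div, ← hcard, div_mul_cancel_right₀ (by positivity), hcard, two_mul, pow_add]
    simp
    field_simp
    ring
  have hsq : ∀ f : Finset α,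
      ((∑ p ∈ P, if s p ⊆ f then (1 : ℝ) else 0) - P.card / 2 ^ m) ^ 2 =
        ∑ p ∈ P, ∑ q ∈ P, ((if s p ⊆ f then (1 : ℝ) else 0) - 1 / 2 ^ m) *
          ((if s q ⊆ f then (1 : ℝ) else 0) - 1 / 2 ^ m) := by
    intro f
    rw [← sum_mul_sum, ← sq, sum_sub_distrib, sum_const, nsmul_eq_mul, mul_one_div]
  simp only [hsq]
  rw [sum_comm, sum_congr rfl fun p _ => sum_comm,
    sum_congr rfl fun p hp => sum_congr rfl (hcov p hp)]
  simp only [← mul_sum, ← sum_div]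
  field_simp

/-- For `k ≥ 0` and `n ≥ 2k`, the variance of the number of `k`-dimensional subcubes contained
in a uniformly random Boolean function of length `n` is
`E[(X_k − μ)²] = Σ_{i=0}^{k} [n!/(i!·(k−i)!·(k−i)!·(n−2k+i)!)] · 2^{n−i} · (2^{2^i} − 1)/2^{2^{k+1}}`,
where `μ = E[X_k] = C(n,k)·2^{n−k}/2^{2^k}`. -/
theorem subcube_variance (n k : ℕ) (hk : 2 * k ≤ n) :
    (1 / (2 : ℝ) ^ (2 ^ n)) * ∑ f : Finset (Fin n → Bool),
        ((subcubeCount n k f : ℝ) - (n.choose k : ℝ) * 2 ^ (n - k) / 2 ^ (2 ^ k)) ^ 2 =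
      ∑ i ∈ Finset.range (k + 1),
        ((n.factorial : ℝ) /
            ((i.factorial : ℝ) * ((k - i).factorial : ℝ) * ((k - i).factorial : ℝ) *
              ((n - 2 * k + i).factorial : ℝ))) *
          2 ^ (n - i) * ((2 : ℝ) ^ (2 ^ i) - 1) / 2 ^ (2 ^ (k + 1)) := by
  have hvar := variance_sum_ite_subset (subcubeCodes n k) (fun p => subcube p.1 p.2) (2 ^ k)
    (fun p hp => by rw [card_subcube, (mem_powersetCard.1 (mem_sigma.1 hp).1).2])
  simp only [← subcubeCount_eq_sum, card_subcubeCodes, Fintype.card_fun, Fintype.card_bool,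
    Fintype.card_fin, Nat.cast_mul, Nat.cast_pow, Nat.cast_ofNat] at hvar
  rw [hvar, ← pow_succ']
  have hcodes : ∑ p ∈ subcubeCodes n k, ∑ q ∈ subcubeCodes n k,
      ((2 : ℝ) ^ (subcube p.1 p.2 ∩ subcube q.1 q.2).card - 1) =
      ∑ T ∈ powersetCard k (univ : Finset (Fin n)), ∑ U ∈ powersetCard k (univ : Finset (Fin n)),
        2 ^ (n - (T ∩ U).card) * ((2 : ℝ) ^ 2 ^ (T ∩ U).card - 1) := by
    simp only [subcubeCodes, sum_sigma]
    refine sum_congr rfl fun T _ => ?_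
    rw [sum_comm]
    refine sum_congr rfl fun U _ => ?_
    rw [sum_two_pow_card_subcube_inter_sub_one]
  rw [hcodes, sum_powersetCard_card_inter n k fun i => 2 ^ (n - i) * ((2 : ℝ) ^ 2 ^ i - 1),
    sum_div]
  refine sum_congr rfl fun i hi => ?_
  rw [choose_mul_choose_mul_choose_eq hk (Nat.lt_succ_iff.1 (mem_range.1 hi)), ← mul_assoc]
end

section
/- For every real number t, the moment generating function of the centralized and normalized inversion number converges to that of the standard normal distribution: lim_{n→∞} (1/n!) Σ_{π ∈ S_n} exp( t · (inv(π) − n(n−1)/4) / σ_n ) = e^{t²/2}, where σ_n = √(n(n−1)(2n+5)/72) and the limit is over integers n ≥ 2. -/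
open Finset Filter

/-- The inversion number of a permutation of `Fin n`: the number of pairs `(i, j)` with
`i < j` and `π i > π j`. -/
def invNum {n : ℕ} (π : Equiv.Perm (Fin n)) : ℕ :=
  ((univ : Finset (Fin n × Fin n)).filter (fun p => p.1 < p.2 ∧ π p.2 < π p.1)).card

/-- The permutation of `Fin (n + 1)` with `0 ↦ p` whose remaining values are in the relative order
prescribed by `e`. -/
def permCons {n : ℕ} (p : Fin (n + 1)) (e : Equiv.Perm (Fin n)) : Equiv.Perm (Fin (n + 1)) :=
  p.cycleRange.symm * Equiv.Perm.decomposeFin.symm (0, e)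

theorem permCons_zero {n : ℕ} (p : Fin (n + 1)) (e : Equiv.Perm (Fin n)) :
    permCons p e 0 = p := by
  simp [permCons]

theorem permCons_succ {n : ℕ} (p : Fin (n + 1)) (e : Equiv.Perm (Fin n)) (i : Fin n) :
    permCons p e i.succ = p.succAbove (e i) := by
  simp [permCons]

theorem permCons_bijective (n : ℕ) :
    Function.Bijective fun x : Fin (n + 1) × Equiv.Perm (Fin n) => permCons x.1 x.2 := by
  rw [Fintype.bijective_iff_injective_and_card]
  constructor
  · rintro ⟨p, e⟩ ⟨q, f⟩ h
    have hpq : p = q := by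
      simpa [permCons_zero] using congrArg (fun σ : Equiv.Perm (Fin (n + 1)) => σ 0) h
    subst hpq
    refine Prod.ext rfl (Equiv.ext fun i => ?_)
    simpa [permCons_succ] using congrArg (fun σ : Equiv.Perm (Fin (n + 1)) => σ i.succ) h
  · simp [Fintype.card_perm, Nat.factorial_succ]

theorem invNum_eq_sum {n : ℕ} (π : Equiv.Perm (Fin n)) :
    invNum π = ∑ i, ∑ j, if i < j ∧ π j < π i then 1 else 0 := by
  rw [invNum, card_filter, ← Fintype.sum_prod_type']

theorem invNum_permCons {n : ℕ} (p : Fin (n + 1)) (e : Equiv.Perm (Fin n)) :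
    invNum (permCons p e) = p + invNum e := by
  have hp : ∑ j, (if p.succAbove (e j) < p then 1 else 0) = (p : ℕ) := by
    rw [Equiv.sum_comp e (fun j => if p.succAbove j < p then 1 else 0)]
    simp only [Fin.succAbove_lt_iff_castSucc_lt]
    rw [← card_filter]
    have : (p : ℕ) ≤ n := by omega
    simp only [Fin.lt_def, Fin.val_castSucc, Fin.card_filter_val_lt]
    omega
  simp [invNum_eq_sum, Fin.sum_univ_succ, permCons_zero, permCons_succ, hp, -sum_boole]

theorem sum_pow_invNum {R : Type*} [CommSemiring R] (x : R) (n : ℕ) :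
    ∑ π : Equiv.Perm (Fin n), x ^ invNum π = ∏ k ∈ range n, ∑ j ∈ range (k + 1), x ^ j := by
  induction n with
  | zero => simp [invNum]
  | succ n ih =>
    rw [← (permCons_bijective n).sum_comp (fun π => x ^ invNum π), Fintype.sum_prod_type,
      prod_range_succ, ← ih, mul_comm, ← Fin.sum_univ_eq_sum_range (fun j => x ^ j), sum_mul_sum]
    simp only [invNum_permCons, pow_add]

theorem exp_le_sinh_div_self {u : ℝ} (hu : u ≠ 0) :
    Real.exp (u ^ 2 / 6 - (u ^ 2 / 6) ^ 2) ≤ Real.sinh u / u := by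
  have hsum := (Real.hasSum_sinh u).div_const u
  have hle := sum_le_hasSum (range 2) (fun m _ => by
    rw [pow_succ, div_right_comm, mul_div_cancel_right₀ _ hu, pow_mul]; positivity) hsum
  have htaylor : 1 + u ^ 2 / 6 ≤ Real.sinh u / u := by
    refine le_trans (le_of_eq ?_) hle
    simp [sum_range_succ, Nat.factorial]
    field_simp
    ring
  refine le_trans ?_ htaylor
  generalize hx : u ^ 2 / 6 = x
  have hx0 : 0 ≤ x := by rw [← hx]; positivity
  have hexp := Real.add_one_le_exp (x ^ 2 - x)
  rw [← neg_sub, Real.exp_neg]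
  refine inv_le_of_inv_le₀ (by positivity) (le_trans ?_ hexp)
  rw [inv_le_iff_one_le_mul₀ (by positivity)]
  nlinarith [pow_nonneg hx0 3]

theorem six_pow_mul_factorial_le (m : ℕ) :
    6 ^ m * m.factorial ≤ (2 * m + 1).factorial := by
  induction m with
  | zero => simp
  | succ m ih =>
    have h : (2 * (m + 1) + 1).factorial = (2 * m + 3) * (2 * m + 2) * (2 * m + 1).factorial := by
      rw [show 2 * (m + 1) + 1 = (2 * m + 1) + 1 + 1 by ring, Nat.factorial_succ, Nat.factorial_succ]
      ring
    rw [h, pow_succ, Nat.factorial_succ]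
    calc 6 ^ m * 6 * ((m + 1) * m.factorial) = 6 * (m + 1) * (6 ^ m * m.factorial) := by ring
      _ ≤ (2 * m + 3) * (2 * m + 2) * (2 * m + 1).factorial :=
        Nat.mul_le_mul (by nlinarith) ih

theorem sinh_div_self_le_exp {u : ℝ} (hu : u ≠ 0) :
    Real.sinh u / u ≤ Real.exp (u ^ 2 / 6) := by
  have hexp : HasSum (fun m : ℕ => (u ^ 2 / 6) ^ m / m.factorial) (Real.exp (u ^ 2 / 6)) := by
    rw [Real.exp_eq_exp_ℝ]
    exact NormedSpace.expSeries_div_hasSum_exp _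
  refine hasSum_le (fun m => ?_) ((Real.hasSum_sinh u).div_const u) hexp
  rw [pow_succ, div_right_comm, mul_div_cancel_right₀ _ hu, div_pow, div_div, pow_mul]
  gcongr
  exact_mod_cast six_pow_mul_factorial_le m

/-- The moment generating function of the uniform distribution on `{0, …, k}`, centred at its
mean. -/
theorem uniform_mgf_eq_sinh_div {s : ℝ} (hs : s ≠ 0) (k : ℕ) :
    Real.exp (-(s * k / 2)) * (∑ j ∈ range (k + 1), Real.exp s ^ j) / (k + 1) =
      (Real.sinh ((k + 1) * s / 2) / ((k + 1) * s / 2)) / (Real.sinh (s / 2) / (s / 2)) := by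
  have hk : (k : ℝ) + 1 ≠ 0 := by positivity
  have hsinh : Real.sinh (s / 2) ≠ 0 := by simpa using hs
  have key : Real.exp (-(s * k / 2)) * (∑ j ∈ range (k + 1), Real.exp s ^ j) * Real.sinh (s / 2) =
      Real.sinh ((k + 1) * s / 2) := by
    have hgeom := geom_sum_mul (Real.exp s) (k + 1)
    have hs2 : Real.sinh (s / 2) = Real.exp (-(s / 2)) * (Real.exp s - 1) / 2 := by
      rw [Real.sinh_eq, mul_sub, ← Real.exp_add]
      ring_nf
    rw [hs2, Real.sinh_eq]
    calc _ = Real.exp (-(s * k / 2)) * Real.exp (-(s / 2)) *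
          ((∑ j ∈ range (k + 1), Real.exp s ^ j) * (Real.exp s - 1)) / 2 := by ring
      _ = _ := by
        rw [hgeom, ← Real.exp_nat_mul, ← Real.exp_add, mul_sub, ← Real.exp_add]
        push_cast
        ring_nf
  rw [← key]
  field_simp

theorem inv_mgf_eq_prod (s : ℝ) (n : ℕ) :
    (1 / (n.factorial : ℝ)) * ∑ π : Equiv.Perm (Fin n),
        Real.exp (s * ((invNum π : ℝ) - (n : ℝ) * ((n : ℝ) - 1) / 4)) =
      ∏ k ∈ range n,
        (Real.exp (-(s * k / 2)) * (∑ j ∈ range (k + 1), Real.exp s ^ j) / (k + 1)) := by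
  have hterm (π : Equiv.Perm (Fin n)) :
      Real.exp (s * ((invNum π : ℝ) - (n : ℝ) * ((n : ℝ) - 1) / 4)) =
        Real.exp (-(s * ((n : ℝ) * ((n : ℝ) - 1) / 4))) * Real.exp s ^ invNum π := by
    rw [← Real.exp_nat_mul, ← Real.exp_add]
    ring_nf
  have hmean : Real.exp (-(s * ((n : ℝ) * ((n : ℝ) - 1) / 4))) =
      ∏ k ∈ range n, Real.exp (-(s * k / 2)) := by
    rw [← Real.exp_sum]
    congr 1
    induction n with
    | zero => simp
    | succ n ih =>
      rw [sum_range_succ, ← ih (fun π => by rw [← Real.exp_nat_mul, ← Real.exp_add]; ring_nf)]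
      push_cast
      ring
  have hfact : (n.factorial : ℝ) = ∏ k ∈ range n, ((k : ℝ) + 1) := by
    rw [← prod_range_add_one_eq_factorial]
    push_cast
    rfl
  simp only [hterm]
  rw [← mul_sum, sum_pow_invNum, hmean, hfact, prod_div_distrib, prod_mul_distrib]
  ring

theorem sum_variance (s : ℝ) (n : ℕ) :
    ∑ k ∈ range n, (((k + 1 : ℝ) * s / 2) ^ 2 / 6 - (s / 2) ^ 2 / 6) =
      s ^ 2 * ((n : ℝ) * (n - 1) * (2 * n + 5) / 72) / 2 := by
  induction n with
  | zero => simp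
  | succ n ih =>
    rw [sum_range_succ, ih]
    push_cast
    ring

theorem inv_mgf_bounds {s : ℝ} (hs : s ≠ 0) (n : ℕ) :
    (1 / (n.factorial : ℝ)) * ∑ π : Equiv.Perm (Fin n),
        Real.exp (s * ((invNum π : ℝ) - (n : ℝ) * ((n : ℝ) - 1) / 4)) ∈
      Set.Icc
        (Real.exp (s ^ 2 * ((n : ℝ) * (n - 1) * (2 * n + 5) / 72) / 2 - n ^ 5 * s ^ 4 / 576))
        (Real.exp (s ^ 2 * ((n : ℝ) * (n - 1) * (2 * n + 5) / 72) / 2 + n ^ 5 * s ^ 4 / 576)) := by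
  have hconst : (n : ℝ) ^ 5 * s ^ 4 / 576 = ∑ k ∈ range n, (n : ℝ) ^ 4 * s ^ 4 / 576 := by
    simp
    ring
  have herr {k : ℝ} (hk0 : 0 ≤ k) (hk : k ≤ n) :
      ((k * s / 2) ^ 2 / 6) ^ 2 ≤ (n : ℝ) ^ 4 * s ^ 4 / 576 := by
    have : k ^ 4 * s ^ 4 ≤ (n : ℝ) ^ 4 * s ^ 4 := by gcongr
    linarith [show ((k * s / 2) ^ 2 / 6) ^ 2 = k ^ 4 * s ^ 4 / 576 by ring]
  have hs2 : s / 2 ≠ 0 := by simpa using hs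
  have hden0 : 0 < Real.sinh (s / 2) / (s / 2) :=
    (Real.exp_pos _).trans_le (exp_le_sinh_div_self hs2)
  rw [inv_mgf_eq_prod, ← sum_variance, hconst, ← sum_sub_distrib, ← sum_add_distrib,
    Real.exp_sum, Real.exp_sum]
  refine ⟨prod_le_prod (fun _ _ => (Real.exp_pos _).le) fun k hk => ?_,
    prod_le_prod (fun _ _ => by positivity) fun k hk => ?_⟩
  all_goals
    have hkn : (k : ℝ) + 1 ≤ n := by exact_mod_cast mem_range.mp hk
    have hks : ((k : ℝ) + 1) * s / 2 ≠ 0 := by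
      have : (k : ℝ) + 1 ≠ 0 := by positivity
      positivity
    rw [uniform_mgf_eq_sinh_div hs]
  · rw [le_div_iff₀ hden0]
    refine le_trans ?_ (exp_le_sinh_div_self hks)
    refine (mul_le_mul_of_nonneg_left (sinh_div_self_le_exp hs2) (Real.exp_pos _).le).trans ?_
    rw [← Real.exp_add, Real.exp_le_exp]
    linarith [herr (by positivity) hkn]
  · rw [div_le_iff₀ hden0]
    refine (sinh_div_self_le_exp hks).trans ?_
    refine le_trans ?_ (mul_le_mul_of_nonneg_left (exp_le_sinh_div_self hs2) (Real.exp_pos _).le)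
    rw [← Real.exp_add, Real.exp_le_exp]
    have := herr zero_le_one (by linarith [(Nat.cast_nonneg k : (0 : ℝ) ≤ k)])
    rw [one_mul] at this
    linarith

/-- For every real `t`, the moment generating function of the centralized and normalized
inversion number converges to that of the standard normal distribution:
`lim_{n→∞} (1/n!) Σ_{π ∈ S_n} exp(t · (inv(π) − n(n−1)/4)/σ_n) = e^{t²/2}`, where
`σ_n = √(n(n−1)(2n+5)/72)`. -/
theorem inv_mgf_gaussian (t : ℝ) :
    Tendsto (fun n : ℕ =>
        (1 / (n.factorial : ℝ)) * ∑ π : Equiv.Perm (Fin n),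
          Real.exp (t * ((invNum π : ℝ) - (n : ℝ) * ((n : ℝ) - 1) / 4) /
            Real.sqrt ((n : ℝ) * ((n : ℝ) - 1) * (2 * (n : ℝ) + 5) / 72)))
      atTop (nhds (Real.exp (t ^ 2 / 2))) := by
  rcases eq_or_ne t 0 with rfl | ht
  · simp [Fintype.card_perm, Nat.factorial_ne_zero]
  have hbounds : ∀ᶠ n : ℕ in atTop,
      (1 / (n.factorial : ℝ)) * ∑ π : Equiv.Perm (Fin n),
          Real.exp (t * ((invNum π : ℝ) - (n : ℝ) * ((n : ℝ) - 1) / 4) /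
            Real.sqrt ((n : ℝ) * ((n : ℝ) - 1) * (2 * (n : ℝ) + 5) / 72)) ∈
        Set.Icc (Real.exp (t ^ 2 / 2 - 9 * t ^ 4 / n)) (Real.exp (t ^ 2 / 2 + 9 * t ^ 4 / n)) := by
    filter_upwards [eventually_ge_atTop 2] with n hn
    have hn2 : (2 : ℝ) ≤ n := by exact_mod_cast hn
    have hn0 : (0 : ℝ) < n := by linarith
    set v : ℝ := (n : ℝ) * ((n : ℝ) - 1) * (2 * (n : ℝ) + 5) / 72 with hv
    have hvn : (n : ℝ) ^ 3 / 72 ≤ v := by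
      rw [hv]
      nlinarith [mul_nonneg hn0.le (sub_nonneg.2 hn2)]
    have hv0 : 0 < v := lt_of_lt_of_le (by positivity) hvn
    have hsq : (t / Real.sqrt v) ^ 2 = t ^ 2 / v := by rw [div_pow, Real.sq_sqrt hv0.le]
    have hvar : (t / Real.sqrt v) ^ 2 * v / 2 = t ^ 2 / 2 := by
      rw [hsq]
      field_simp
    have herr : (n : ℝ) ^ 5 * (t / Real.sqrt v) ^ 4 / 576 ≤ 9 * t ^ 4 / n := by
      rw [show (t / Real.sqrt v) ^ 4 = ((t / Real.sqrt v) ^ 2) ^ 2 by ring, hsq, div_pow]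
      calc (n : ℝ) ^ 5 * ((t ^ 2) ^ 2 / v ^ 2) / 576
          ≤ (n : ℝ) ^ 5 * ((t ^ 2) ^ 2 / ((n : ℝ) ^ 3 / 72) ^ 2) / 576 := by gcongr
        _ = 9 * t ^ 4 / n := by
          field_simp
          norm_num
    have h := inv_mgf_bounds (div_ne_zero ht (Real.sqrt_pos.2 hv0).ne') n
    rw [← hv, hvar] at h
    simp only [mul_div_right_comm t]
    exact ⟨le_trans (Real.exp_le_exp.2 (by linarith)) h.1,
      h.2.trans (Real.exp_le_exp.2 (by linarith))⟩
  have herr := tendsto_const_div_atTop_nhds_zero_nat (9 * t ^ 4)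
  have hexp := Real.continuous_exp.tendsto (t ^ 2 / 2)
  refine tendsto_of_tendsto_of_tendsto_of_le_of_le'
    (hexp.comp (by simpa using herr.const_sub (t ^ 2 / 2)))
    (hexp.comp (by simpa using herr.const_add (t ^ 2 / 2))) ?_ ?_
  · filter_upwards [hbounds] with n hn using hn.1
  · filter_upwards [hbounds] with n hn using hn.2
end
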